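/- Let B be a simple Bratteli diagram of finite rank with incidence matrices (F_n)_{n≥1}, and let A_n = F_n^T. Then B is uniquely ergodic — that is, there is exactly one R-invariant Borel probability measure on X_B — if and only if lim_{n→∞} τ(A_m A_{m+1} ⋯ A_n) = 0 for every m. -/

import Mathlib

open MeasureTheory

/-- A Bratteli diagram. -/
structure BratteliDiagram where
  V : ℕ → Type
  E : ℕ → Type
  fintypeV : ∀ n, Fintype (V n)
  fintypeE : ∀ n, Fintype (E n)
  nonemptyV : ∀ n, Nonempty (V n)
  nonemptyE : ∀ n, Nonempty (E n)
  root_subsingleton : ∀ v w : V 0, v = w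
  src : ∀ n, E n → V n
  rng : ∀ n, E n → V (n + 1)
  src_surj : ∀ n, Function.Surjective (src n)
  rng_surj : ∀ n, Function.Surjective (rng n)

attribute [instance] BratteliDiagram.fintypeV BratteliDiagram.fintypeE
  BratteliDiagram.nonemptyV BratteliDiagram.nonemptyE

namespace BratteliDiagram

variable (B : BratteliDiagram)

instance (n : ℕ) : TopologicalSpace (B.E n) := ⊥

/-- The path space `X_B` of a Bratteli diagram. -/
def PathSpace : Type :=
  { x : ∀ n, B.E n // ∀ n, B.rng n (x n) = B.src (n + 1) (x (n + 1)) }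

instance : TopologicalSpace B.PathSpace := by unfold PathSpace; infer_instance

noncomputable instance : MeasurableSpace B.PathSpace := borel _

/-- The vertex at level `n` through which a path passes. -/
def endVtx (n : ℕ) (x : B.PathSpace) : B.V n := B.src n (x.1 n)

/-- The cylinder set of paths agreeing with `x` on the first `n` edges. -/
def cyl (n : ℕ) (x : B.PathSpace) : Set B.PathSpace := { y | ∀ i < n, y.1 i = x.1 i }

/-- Tail equivalence of paths. -/
def tailEq (x y : B.PathSpace) : Prop := ∃ N, ∀ n, N ≤ n → x.1 n = y.1 n

/-- The tail equivalence relation is aperiodic: all classes are infinite. -/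
def TailAperiodic : Prop := ∀ x : B.PathSpace, { y | B.tailEq x y }.Infinite

/-- A measure is invariant for the tail equivalence relation if any two
cylinder sets ending at the same vertex have equal measure. -/
def TailInvariant (μ : Measure B.PathSpace) : Prop :=
  ∀ (n : ℕ) (x y : B.PathSpace), B.endVtx n x = B.endVtx n y →
    μ (B.cyl n x) = μ (B.cyl n y)

/-- Ergodicity with respect to the tail equivalence relation. -/
def TailErgodic (μ : Measure B.PathSpace) : Prop :=
  ∀ S : Set B.PathSpace, MeasurableSet S →
    (∀ x y, B.tailEq x y → (x ∈ S ↔ y ∈ S)) → μ S = 0 ∨ μ Sᶜ = 0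

/-- The type of finite paths from the root vertex to `v`. -/
def FinPathTo : ∀ n, B.V n → Type
  | 0, _ => PUnit
  | n + 1, v => Σ e : { e : B.E n // B.rng n e = v }, FinPathTo n (B.src n e.1)

/-- The height `h_v^{(n)}`: the number of finite paths from the root to `v`. -/
noncomputable def height (n : ℕ) (v : B.V n) : ℕ := Nat.card (B.FinPathTo n v)

/-- The number of edges from `w ∈ V_n` to `v ∈ V_{n+1}`; the entry `f^{(n)}_{v,w}`
of the incidence matrix `F_n`. -/
noncomputable def edgeCount (n : ℕ) (v : B.V (n + 1)) (w : B.V n) : ℕ :=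
  Nat.card { e : B.E n // B.rng n e = v ∧ B.src n e = w }

/-- The incidence matrix `F_n`, as a real matrix. -/
noncomputable def incMat (n : ℕ) : Matrix (B.V (n + 1)) (B.V n) ℝ :=
  fun v w => (B.edgeCount n v w : ℝ)

end BratteliDiagram

/-- The Hilbert projective metric `D(x,y) = log max_{i,j} (x_i y_j)/(x_j y_i)`. -/
noncomputable def hilbertDist {ι : Type} [Fintype ι] (x y : ι → ℝ) : ℝ :=
  Real.log (⨆ p : ι × ι, x p.1 * y p.2 / (x p.2 * y p.1))

/-- The Birkhoff contraction coefficient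
`τ(M) = sup { D(Mx, My)/D(x,y) : x, y > 0 }`. -/
noncomputable def birkhoffTau {κ ι : Type} [Fintype ι] [Fintype κ]
    (M : Matrix κ ι ℝ) : ℝ :=
  sSup { t : ℝ | ∃ x y : ι → ℝ, (∀ i, 0 < x i) ∧ (∀ i, 0 < y i) ∧
    t = hilbertDist (M.mulVec x) (M.mulVec y) / hilbertDist x y }

namespace BratteliDiagram

variable (B : BratteliDiagram)

/-- The matrix product `A_m A_{m+1} ⋯ A_{m+j}` of the transposed incidence matrices. -/
noncomputable def transProd (m : ℕ) : ∀ j : ℕ, Matrix (B.V m) (B.V (m + j + 1)) ℝ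
  | 0 => (B.incMat m).transpose
  | j + 1 => transProd m j * (B.incMat (m + j + 1)).transpose

/-- There is a finite path from `v ∈ V_n` to `w ∈ V_{n+j}`. -/
def reaches (n : ℕ) : ∀ j : ℕ, B.V n → B.V (n + j) → Prop
  | 0, v, w => v = w
  | j + 1, v, w => ∃ e : B.E (n + j), reaches n j v (B.src (n + j) e) ∧ B.rng (n + j) e = w

/-- A Bratteli diagram is simple if any vertex of any level is connected to every vertex
of some deeper level. -/
def IsSimple : Prop :=
  ∀ n : ℕ, ∃ j : ℕ, 1 ≤ j ∧ ∀ (v : B.V n) (w : B.V (n + j)), B.reaches n j v w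

/-- A Bratteli diagram has finite rank if the number of vertices per level is bounded. -/
def FiniteRank : Prop := ∃ k : ℕ, ∀ n : ℕ, Nat.card (B.V n) ≤ k

end BratteliDiagram

/-! ### Contraction coefficients of positive matrices -/

section Birkhoff

variable {ι κ : Type} [Fintype ι] [Fintype κ]

lemma log_le_hilbertDist (x y : ι → ℝ) (i j : ι) (h : 0 < x i * y j / (x j * y i)) :
    Real.log (x i * y j / (x j * y i)) ≤ hilbertDist x y :=
  Real.log_le_log h
    (le_ciSup (f := fun p : ι × ι => x p.1 * y p.2 / (x p.2 * y p.1))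
      (Set.finite_range _).bddAbove (i, j))

lemma hilbertDist_le_log [Nonempty ι] {x y : ι → ℝ} (hx : ∀ i, 0 < x i) (hy : ∀ i, 0 < y i)
    {C : ℝ} (h : ∀ i j, x i * y j ≤ C * (x j * y i)) : hilbertDist x y ≤ Real.log C := by
  obtain ⟨i⟩ := ‹Nonempty ι›
  have hp : 0 < x i * y i / (x i * y i) :=
    div_pos (mul_pos (hx i) (hy i)) (mul_pos (hx i) (hy i))
  refine Real.log_le_log (hp.trans_le (le_ciSup
    (f := fun p : ι × ι => x p.1 * y p.2 / (x p.2 * y p.1))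
      (Set.finite_range _).bddAbove (i, i))) ?_
  have : Nonempty (ι × ι) := ⟨(i, i)⟩
  exact ciSup_le fun p => (div_le_iff₀ (mul_pos (hx _) (hy _))).2 (h _ _)

lemma hilbertDist_nonneg [Nonempty ι] {x y : ι → ℝ} (hx : ∀ i, 0 < x i) (hy : ∀ i, 0 < y i) :
    0 ≤ hilbertDist x y := by
  obtain ⟨i⟩ := ‹Nonempty ι›
  have h1 : x i * y i / (x i * y i) = 1 := div_self (mul_pos (hx i) (hy i)).ne'
  simpa [h1] using log_le_hilbertDist x y i i (by rw [h1]; exact one_pos)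

lemma mul_le_exp_hilbertDist {x y : ι → ℝ} (hx : ∀ i, 0 < x i) (hy : ∀ i, 0 < y i) (i j : ι) :
    x i * y j ≤ Real.exp (hilbertDist x y) * (x j * y i) := by
  have hp : 0 < x i * y j / (x j * y i) :=
    div_pos (mul_pos (hx i) (hy j)) (mul_pos (hx j) (hy i))
  have := (Real.log_le_iff_le_exp hp).1 (log_le_hilbertDist x y i j hp)
  exact (div_le_iff₀ (mul_pos (hx _) (hy _))).1 this

omit [Fintype κ] in
lemma mulVec_pos [Nonempty ι] {P : Matrix κ ι ℝ} (hP : ∀ i k, 0 < P i k) {x : ι → ℝ}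
    (hx : ∀ k, 0 < x k) (i : κ) : 0 < P.mulVec x i :=
  Finset.sum_pos (fun k _ => mul_pos (hP i k) (hx k)) Finset.univ_nonempty

omit [Fintype κ] in
lemma mulVec_mul_mulVec_le {P : Matrix κ ι ℝ} {C : ℝ} {i j : κ}
    (h : ∀ k l, P i k * P j l ≤ C * (P j k * P i l)) {x y : ι → ℝ}
    (hx : ∀ k, 0 ≤ x k) (hy : ∀ k, 0 ≤ y k) :
    P.mulVec x i * P.mulVec y j ≤ C * (P.mulVec x j * P.mulVec y i) := by
  simp only [Matrix.mulVec, dotProduct]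
  rw [Finset.sum_mul_sum, Finset.sum_mul_sum, Finset.mul_sum]
  simp only [Finset.mul_sum]
  refine Finset.sum_le_sum fun k _ => Finset.sum_le_sum fun l _ => ?_
  have := mul_le_mul_of_nonneg_right (h k l) (mul_nonneg (hx k) (hy l))
  linarith

lemma hilbertDist_mulVec_le [Nonempty ι] [Nonempty κ] {P : Matrix κ ι ℝ}
    (hP : ∀ i k, 0 < P i k) {δ : ℝ} (hδ : 0 ≤ δ)
    (h : ∀ i j k l, P i k * P j l ≤ (1 + δ) * (P j k * P i l)) {x y : ι → ℝ}
    (hx : ∀ k, 0 < x k) (hy : ∀ k, 0 < y k) :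
    hilbertDist (P.mulVec x) (P.mulVec y) ≤ δ * hilbertDist x y := by
  set D := hilbertDist x y with hD
  rw [← Real.log_exp (δ * D)]
  refine hilbertDist_le_log (mulVec_pos hP hx) (mulVec_pos hP hy) fun i j => ?_
  obtain ⟨k₀, hk₀⟩ := Finite.exists_min fun k => x k / y k
  set c := x k₀ / y k₀ with hc
  have hu : ∀ k, 0 ≤ x k - c * y k := fun k => by
    have := (le_div_iff₀ (hy k)).1 (hk₀ k)
    linarith
  have hu' : ∀ k, x k - c * y k ≤ D * x k := fun k => by
    have h1 := mul_le_exp_hilbertDist hx hy k k₀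
    rw [← hD] at h1
    have h2 : Real.exp (-D) * x k ≤ c * y k := by
      rw [hc, div_mul_eq_mul_div, le_div_iff₀ (hy k₀), Real.exp_neg, mul_assoc,
        inv_mul_le_iff₀ (Real.exp_pos D)]
      linarith
    have h3 := mul_le_mul_of_nonneg_right (Real.add_one_le_exp (-D)) (hx k).le
    linarith
  have hsub : P.mulVec (fun k => x k - c * y k) = P.mulVec x - c • P.mulVec y := by
    rw [← Matrix.mulVec_smul, ← Matrix.mulVec_sub]
    rfl
  have h1 := mulVec_mul_mulVec_le (h i j) hu (fun k => (hy k).le)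
  have h2 : P.mulVec (fun k => x k - c * y k) j ≤ D * P.mulVec x j := by
    simp only [Matrix.mulVec, dotProduct, Finset.mul_sum]
    refine Finset.sum_le_sum fun k _ => ?_
    have := mul_le_mul_of_nonneg_left (hu' k) (hP j k).le
    linarith
  rw [hsub] at h1 h2
  simp only [Pi.sub_apply, Pi.smul_apply, smul_eq_mul] at h1 h2
  have hxj := mulVec_pos hP hx j
  have hyi := mulVec_pos hP hy i
  have h3 := mul_le_mul_of_nonneg_left (mul_le_mul_of_nonneg_right h2 hyi.le) hδ
  have h4 := mul_le_mul_of_nonneg_right (Real.add_one_le_exp (δ * D)) (mul_pos hxj hyi).le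
  linarith

lemma exists_cross_ratio_bound {P : Matrix κ ι ℝ} (hP : ∀ i k, 0 < P i k) :
    ∃ δ : ℝ, 0 ≤ δ ∧ ∀ i j k l, P i k * P j l ≤ (1 + δ) * (P j k * P i l) := by
  obtain ⟨C, hC⟩ := (Set.finite_range fun p : (κ × κ) × ι × ι =>
    P p.1.1 p.2.1 * P p.1.2 p.2.2 / (P p.1.2 p.2.1 * P p.1.1 p.2.2)).bddAbove
  refine ⟨max C 0, le_max_right _ _, fun i j k l => ?_⟩
  have h1 := hC ⟨((i, j), k, l), rfl⟩
  have hp := mul_pos (hP j k) (hP i l)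
  have h2 := (div_le_iff₀ hp).1 h1
  have h3 := mul_le_mul_of_nonneg_right (le_max_left C 0) hp.le
  dsimp only at h2
  linarith

lemma birkhoffTau_nonneg [Nonempty ι] [Nonempty κ] {P : Matrix κ ι ℝ}
    (hP : ∀ i k, 0 < P i k) : 0 ≤ birkhoffTau P := by
  refine Real.sSup_nonneg ?_
  rintro _ ⟨x, y, hx, hy, rfl⟩
  exact div_nonneg (hilbertDist_nonneg (mulVec_pos hP hx) (mulVec_pos hP hy))
    (hilbertDist_nonneg hx hy)

lemma birkhoffTau_le [Nonempty ι] [Nonempty κ] {P : Matrix κ ι ℝ}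
    (hP : ∀ i k, 0 < P i k) {δ : ℝ} (hδ : 0 ≤ δ)
    (h : ∀ i j k l, P i k * P j l ≤ (1 + δ) * (P j k * P i l)) : birkhoffTau P ≤ δ := by
  refine Real.sSup_le ?_ hδ
  rintro _ ⟨x, y, hx, hy, rfl⟩
  exact div_le_of_le_mul₀ (hilbertDist_nonneg hx hy) hδ (hilbertDist_mulVec_le hP hδ h hx hy)

lemma hilbertDist_mulVec_le_birkhoffTau [Nonempty ι] [Nonempty κ] {P : Matrix κ ι ℝ}
    (hP : ∀ i k, 0 < P i k) {x y : ι → ℝ} (hx : ∀ k, 0 < x k) (hy : ∀ k, 0 < y k) :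
    hilbertDist (P.mulVec x) (P.mulVec y) ≤ birkhoffTau P * hilbertDist x y := by
  obtain ⟨δ, hδ, h⟩ := exists_cross_ratio_bound hP
  have hle := hilbertDist_mulVec_le hP hδ h hx hy
  rcases (hilbertDist_nonneg hx hy).eq_or_lt with h0 | h0
  · rw [← h0] at hle ⊢
    simpa using hle
  · rw [← div_le_iff₀ h0]
    refine le_csSup ⟨δ, ?_⟩ ⟨x, y, hx, hy, rfl⟩
    rintro _ ⟨x', y', hx', hy', rfl⟩
    exact div_le_of_le_mul₀ (hilbertDist_nonneg hx' hy') hδ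
      (hilbertDist_mulVec_le hP hδ h hx' hy')

/-- If two vectors are images of positive vectors under a positive matrix `P`, then each of
their cross ratios `u / v` is constrained by the contraction coefficient of `P`. -/
lemma sq_le_of_birkhoffTau [Nonempty ι] [Nonempty κ] {P : Matrix κ ι ℝ}
    (hP : ∀ i k, 0 < P i k) {x y : ι → ℝ} (hx : ∀ k, 0 < x k) (hy : ∀ k, 0 < y k) {i j : κ}
    {u v : ℝ} (hu : P.mulVec y i = u * P.mulVec x i) (hv : P.mulVec y j = v * P.mulVec x j)
    (hv0 : 0 < v) (hvu : v ≤ u) :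
    (u + v) ^ 2 ≤ 4 * (u * v) * Real.exp (birkhoffTau P * Real.log (u / v)) := by
  have hu0 : 0 < u := hv0.trans_le hvu
  have hpos : ∀ s : ℝ, 0 < s → ∀ k, 0 < (x + s • y) k := fun s hs k =>
    add_pos (hx k) (mul_pos hs (hy k))
  have hz := hpos v⁻¹ (inv_pos.2 hv0)
  have hw := hpos u⁻¹ (inv_pos.2 hu0)
  have hinv : u⁻¹ ≤ v⁻¹ := inv_anti₀ hv0 hvu
  have hD : hilbertDist (x + v⁻¹ • y) (x + u⁻¹ • y) ≤ Real.log (u / v) := by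
    refine hilbertDist_le_log hz hw fun k l => ?_
    have h1 : (x + v⁻¹ • y) k ≤ (u / v) * (x + u⁻¹ • y) k := by
      have : (u / v) * (x + u⁻¹ • y) k = (u / v) * x k + v⁻¹ * y k := by
        simp only [Pi.add_apply, Pi.smul_apply, smul_eq_mul]
        field_simp
      rw [this]
      have h1 : 1 * x k ≤ (u / v) * x k :=
        mul_le_mul_of_nonneg_right ((one_le_div hv0).2 hvu) (hx k).le
      simp only [Pi.add_apply, Pi.smul_apply, smul_eq_mul]
      linarith
    have h2 : (x + u⁻¹ • y) l ≤ (x + v⁻¹ • y) l := by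
      simp only [Pi.add_apply, Pi.smul_apply, smul_eq_mul]
      have := mul_le_mul_of_nonneg_right hinv (hy l).le
      linarith
    calc _ ≤ ((u / v) * (x + u⁻¹ • y) k) * (x + v⁻¹ • y) l :=
          mul_le_mul h1 h2 (hw l).le (mul_pos (div_pos hu0 hv0) (hw k)).le
      _ = _ := by ring
  have h1 := mul_le_exp_hilbertDist (mulVec_pos hP hz) (mulVec_pos hP hw) i j
  have h2 := (hilbertDist_mulVec_le_birkhoffTau hP hz hw).trans
    (mul_le_mul_of_nonneg_left hD (birkhoffTau_nonneg hP))
  simp only [Matrix.mulVec_add, Matrix.mulVec_smul] at h1 h2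
  simp only [Pi.add_apply, Pi.smul_apply, smul_eq_mul, hu, hv] at h1
  have h3 := Real.exp_le_exp.2 h2
  have hxi := mulVec_pos hP hx i
  have hxj := mulVec_pos hP hx j
  have hm : 0 < P.mulVec x i * P.mulVec x j := mul_pos hxi hxj
  set E := Real.exp (hilbertDist (P.mulVec x + v⁻¹ • P.mulVec y)
    (P.mulVec x + u⁻¹ • P.mulVec y))
  have h4 : (u + v) ^ 2 * (P.mulVec x i * P.mulVec x j) ≤
      4 * (u * v) * E * (P.mulVec x i * P.mulVec x j) := by
    have h5 := mul_le_mul_of_nonneg_left h1 (mul_pos hu0 hv0).le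
    calc _ = u * v * ((P.mulVec x i + v⁻¹ * (u * P.mulVec x i)) *
            (P.mulVec x j + u⁻¹ * (v * P.mulVec x j))) := by field_simp; ring
      _ ≤ _ := h5
      _ = _ := by field_simp; ring
  refine (le_of_mul_le_mul_right h4 hm).trans ?_
  exact mul_le_mul_of_nonneg_left h3 (by positivity)

end Birkhoff

namespace BratteliDiagram

variable {B : BratteliDiagram}

/-! ### The path space -/

lemma exists_path_extending (n : ℕ) (z : ∀ i, B.E i)
    (hz : ∀ i < n, B.rng i (z i) = B.src (i + 1) (z (i + 1))) :
    ∃ y : B.PathSpace, ∀ i ≤ n, y.1 i = z i := by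
  choose next hnext using fun i (e : B.E i) => B.src_surj (i + 1) (B.rng i e)
  let y : ∀ i, B.E i := fun i => Nat.rec (motive := B.E) (z 0)
    (fun i e => if i + 1 ≤ n then z (i + 1) else next i e) i
  have hy1 : ∀ i, y (i + 1) = if i + 1 ≤ n then z (i + 1) else next i (y i) := fun _ => rfl
  have hy : ∀ i ≤ n, y i = z i := by
    rintro (_ | i) hi
    · rfl
    · rw [hy1, if_pos hi]
  refine ⟨⟨y, fun i => ?_⟩, hy⟩
  by_cases hi : i + 1 ≤ n
  · rw [hy i (by omega), hy _ hi]
    exact hz i hi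
  · rw [hy1, if_neg hi, hnext]

lemma rng_eq_endVtx (x : B.PathSpace) (n : ℕ) : B.rng n (x.1 n) = B.endVtx (n + 1) x := x.2 n

lemma exists_path_of_edge (n : ℕ) (e : B.E n) : ∃ x : B.PathSpace, x.1 n = e := by
  induction n with
  | zero =>
    obtain ⟨y, hy⟩ := exists_path_extending 0
      (Function.update (fun i => Classical.arbitrary (B.E i)) 0 e) (by simp)
    exact ⟨y, by simpa using hy 0 le_rfl⟩
  | succ n ih =>
    obtain ⟨e', he'⟩ := B.rng_surj n (B.src (n + 1) e)
    obtain ⟨x, hx⟩ := ih e'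
    obtain ⟨y, hy⟩ := exists_path_extending (n + 1) (Function.update x.1 (n + 1) e) (by
      intro i hi
      rw [Function.update_of_ne (by omega)]
      rcases Nat.lt_succ_iff_lt_or_eq.1 hi with h | rfl
      · rw [Function.update_of_ne (by omega)]
        exact x.2 i
      · rw [Function.update_self, hx, he'])
    exact ⟨y, by simpa using hy (n + 1) le_rfl⟩

lemma exists_path_endVtx (n : ℕ) (v : B.V n) : ∃ x : B.PathSpace, B.endVtx n x = v := by
  obtain ⟨e, he⟩ := B.src_surj n v
  obtain ⟨x, hx⟩ := exists_path_of_edge n e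
  exact ⟨x, by rw [endVtx, hx, he]⟩

instance : Nonempty B.PathSpace :=
  ⟨(exists_path_of_edge 0 (Classical.arbitrary (B.E 0))).choose⟩

lemma exists_mem_cyl_of_edge (n : ℕ) (x : B.PathSpace) (e : B.E n)
    (he : B.src n e = B.endVtx n x) : ∃ y ∈ B.cyl n x, y.1 n = e := by
  obtain ⟨y, hy⟩ := exists_path_extending n (Function.update x.1 n e) (by
    intro i hi
    rw [Function.update_of_ne hi.ne]
    by_cases h : i + 1 = n
    · subst h
      rw [Function.update_self, he]
      exact x.2 i
    · rw [Function.update_of_ne h]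
      exact x.2 i)
  refine ⟨y, fun i hi => ?_, by simpa using hy n le_rfl⟩
  rw [hy i hi.le, Function.update_of_ne hi.ne]

lemma mem_cyl_self (n : ℕ) (x : B.PathSpace) : x ∈ B.cyl n x := fun _ _ => rfl

lemma cyl_zero (x : B.PathSpace) : B.cyl 0 x = Set.univ := by
  ext y
  simp [cyl]

lemma cyl_anti {m n : ℕ} (h : m ≤ n) (x : B.PathSpace) : B.cyl n x ⊆ B.cyl m x :=
  fun _ hy i hi => hy i (hi.trans_le h)

lemma cyl_eq_of_mem {n : ℕ} {x y : B.PathSpace} (h : y ∈ B.cyl n x) : B.cyl n y = B.cyl n x := by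
  ext z
  exact forall₂_congr fun i hi => by rw [h i hi]

lemma mem_cyl_succ {n : ℕ} {x y : B.PathSpace} :
    y ∈ B.cyl (n + 1) x ↔ y ∈ B.cyl n x ∧ y.1 n = x.1 n := by
  refine ⟨fun h => ⟨cyl_anti n.le_succ x h, h n n.lt_succ_self⟩, fun h i hi => ?_⟩
  rcases Nat.lt_succ_iff_lt_or_eq.1 hi with hi | rfl
  · exact h.1 i hi
  · exact h.2

lemma endVtx_eq_of_mem_cyl {n : ℕ} {x y : B.PathSpace} (h : y ∈ B.cyl n x) :
    B.endVtx n y = B.endVtx n x := by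
  cases n with
  | zero => exact B.root_subsingleton _ _
  | succ n => rw [← rng_eq_endVtx, ← rng_eq_endVtx, (mem_cyl_succ.1 h).2]

instance (n : ℕ) : DiscreteTopology (B.E n) := ⟨rfl⟩

instance : BorelSpace B.PathSpace := ⟨rfl⟩

lemma isClosed_setOf_path :
    IsClosed { x : ∀ n, B.E n | ∀ n, B.rng n (x n) = B.src (n + 1) (x (n + 1)) } := by
  rw [Set.ofPred_forall]
  refine isClosed_iInter fun n => ?_
  have h : Continuous fun x : ∀ n, B.E n => (x n, x (n + 1)) :=
    (continuous_apply n).prodMk (continuous_apply (n + 1))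
  exact (isClosed_discrete { p : B.E n × B.E (n + 1) | B.rng n p.1 = B.src (n + 1) p.2 }).preimage h

instance : CompactSpace B.PathSpace :=
  isCompact_iff_compactSpace.1 isClosed_setOf_path.isCompact

instance : T2Space B.PathSpace := inferInstanceAs (T2Space (Subtype _))

instance (n : ℕ) : SecondCountableTopology (B.E n) :=
  DiscreteTopology.secondCountableTopology_of_countable

instance : SecondCountableTopology B.PathSpace :=
  (Topology.IsEmbedding.subtypeVal (X := ∀ n, B.E n)).secondCountableTopology

lemma isTopologicalBasis_cyl :
    TopologicalSpace.IsTopologicalBasis { s | ∃ n, ∃ x : B.PathSpace, s = B.cyl n x } := by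
  have h := (PiNat.isTopologicalBasis_cylinders B.E).induced
    (Subtype.val : B.PathSpace → ∀ n, B.E n)
  refine TopologicalSpace.isTopologicalBasis_of_isOpen_of_nhds ?_ fun x u hx hu => ?_
  · rintro _ ⟨n, x, rfl⟩
    exact h.isOpen ⟨_, ⟨x.1, n, rfl⟩, rfl⟩
  · obtain ⟨_, ⟨_, ⟨z, n, rfl⟩, rfl⟩, hxz, hsub⟩ := h.exists_subset_of_mem_open hx hu
    refine ⟨_, ⟨n, x, rfl⟩, mem_cyl_self n x, fun y hy => hsub fun i hi => ?_⟩
    rw [hy i hi]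
    exact hxz i hi

lemma isOpen_cyl (n : ℕ) (x : B.PathSpace) : IsOpen (B.cyl n x) :=
  isTopologicalBasis_cyl.isOpen ⟨n, x, rfl⟩

lemma isClopen_cyl (n : ℕ) (x : B.PathSpace) : IsClopen (B.cyl n x) := by
  refine ⟨⟨?_⟩, isOpen_cyl n x⟩
  have : (B.cyl n x)ᶜ = ⋃ y ∈ (B.cyl n x)ᶜ, B.cyl n y := by
    refine Set.Subset.antisymm (fun y hy => Set.mem_biUnion hy (mem_cyl_self n y)) ?_
    refine Set.iUnion₂_subset fun y hy z hz hzx => hy ?_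
    rw [← cyl_eq_of_mem hzx, cyl_eq_of_mem hz]
    exact mem_cyl_self n y
  rw [this]
  exact isOpen_biUnion fun y _ => isOpen_cyl n y

lemma measurableSet_cyl (n : ℕ) (x : B.PathSpace) : MeasurableSet (B.cyl n x) :=
  (isOpen_cyl n x).measurableSet

lemma measure_ext_cyl {μ ν : Measure B.PathSpace} [IsFiniteMeasure μ]
    (h : ∀ n x, μ (B.cyl n x) = ν (B.cyl n x)) : μ = ν := by
  refine ext_of_generate_finite _ isTopologicalBasis_cyl.borel_eq_generateFrom ?_ ?_ ?_
  · rintro _ ⟨m, x, rfl⟩ _ ⟨n, y, rfl⟩ ⟨z, hzx, hzy⟩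
    rcases le_total m n with hmn | hmn
    · refine ⟨n, z, ?_⟩
      rw [← cyl_eq_of_mem hzx, ← cyl_eq_of_mem hzy]
      exact Set.inter_eq_right.2 (cyl_anti hmn z)
    · refine ⟨m, z, ?_⟩
      rw [← cyl_eq_of_mem hzx, ← cyl_eq_of_mem hzy]
      exact Set.inter_eq_left.2 (cyl_anti hmn z)
  · rintro _ ⟨n, x, rfl⟩
    exact h n x
  · rw [← cyl_zero (Classical.arbitrary B.PathSpace)]
    exact h _ _

end BratteliDiagram

namespace BratteliDiagram

variable {B : BratteliDiagram}

/-! ### Products of transposed incidence matrices -/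

open Classical in
lemma incMat_transpose_mulVec (n : ℕ) (x : B.V (n + 1) → ℝ) (w : B.V n) :
    (B.incMat n).transpose.mulVec x w = ∑ e with B.src n e = w, x (B.rng n e) := by
  have h : ∀ v, B.incMat n v w = ∑ e, if B.rng n e = v ∧ B.src n e = w then (1 : ℝ) else 0 := by
    intro v
    rw [incMat, edgeCount, Nat.card_eq_fintype_card, Fintype.card_subtype, Finset.sum_boole]
  simp only [Matrix.mulVec, dotProduct, Matrix.transpose_apply, h, Finset.sum_mul]
  rw [Finset.sum_comm, Finset.sum_filter]
  refine Finset.sum_congr rfl fun e _ => ?_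
  by_cases he : B.src n e = w <;> simp [he]

lemma incMat_nonneg (n : ℕ) (v : B.V (n + 1)) (w : B.V n) : 0 ≤ B.incMat n v w :=
  Nat.cast_nonneg _

lemma incMat_pos_of_edge (n : ℕ) (e : B.E n) : 0 < B.incMat n (B.rng n e) (B.src n e) := by
  rw [incMat, edgeCount, Nat.cast_pos, Nat.card_pos_iff]
  exact ⟨⟨e, rfl, rfl⟩, inferInstance⟩

lemma transProd_nonneg (m j : ℕ) (v : B.V m) (w : B.V (m + j + 1)) :
    0 ≤ B.transProd m j v w := by
  induction j with
  | zero => exact incMat_nonneg _ _ _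
  | succ j ih =>
    rw [transProd, Matrix.mul_apply]
    exact Finset.sum_nonneg fun u _ => mul_nonneg (ih u) (incMat_nonneg _ _ _)

lemma transProd_succ_pos_of_edge {m j : ℕ} {v : B.V m} (e : B.E (m + j + 1))
    (h : 0 < B.transProd m j v (B.src _ e)) : 0 < B.transProd m (j + 1) v (B.rng _ e) := by
  rw [transProd, Matrix.mul_apply]
  exact Finset.sum_pos' (fun u _ => mul_nonneg (transProd_nonneg _ _ _ _) (incMat_nonneg _ _ _))
    ⟨B.src _ e, Finset.mem_univ _, mul_pos h (incMat_pos_of_edge _ e)⟩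

lemma transProd_pos_of_reaches {m j : ℕ} {v : B.V m} {w : B.V (m + j + 1)}
    (h : B.reaches m (j + 1) v w) : 0 < B.transProd m j v w := by
  induction j with
  | zero =>
    obtain ⟨e, rfl, rfl⟩ := h
    exact incMat_pos_of_edge m e
  | succ j ih =>
    obtain ⟨e, he, rfl⟩ := h
    exact transProd_succ_pos_of_edge e (ih he)

lemma IsSimple.exists_transProd_pos (hB : B.IsSimple) (m : ℕ) :
    ∃ j₀, ∀ j ≥ j₀, ∀ v w, 0 < B.transProd m j v w := by
  obtain ⟨j₁, hj₁, h⟩ := hB m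
  obtain ⟨j₀, rfl⟩ := Nat.exists_eq_add_of_le' hj₁
  refine ⟨j₀, fun j hj => ?_⟩
  induction j, hj using Nat.le_induction with
  | base => exact fun v w => transProd_pos_of_reaches (h v w)
  | succ j hj ih =>
    intro v w
    obtain ⟨e, rfl⟩ := B.rng_surj _ w
    exact transProd_succ_pos_of_edge e (ih v _)

/-! ### Invariant sequences of vectors -/

variable (B) in
/-- A sequence of nonnegative vectors on the levels, normalised at the root and compatible with
the transposed incidence matrices: the possible cylinder values of an invariant measure. -/
structure IsInvariantSeq (q : ∀ n, B.V n → ℝ) : Prop where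
  nonneg : ∀ n v, 0 ≤ q n v
  root : ∀ v, q 0 v = 1
  step : ∀ n, q n = (B.incMat n).transpose.mulVec (q (n + 1))

lemma eq_transProd_mulVec {q : ∀ n, B.V n → ℝ} (m j : ℕ)
    (hq : ∀ n < m + j + 1, q n = (B.incMat n).transpose.mulVec (q (n + 1))) :
    q m = (B.transProd m j).mulVec (q (m + j + 1)) := by
  induction j with
  | zero => exact hq m (by omega)
  | succ j ih =>
    rw [ih fun n hn => hq n (by omega), hq (m + j + 1) (by omega), Matrix.mulVec_mulVec]
    rfl

lemma IsInvariantSeq.pos {q : ∀ n, B.V n → ℝ} (hq : B.IsInvariantSeq q) (hB : B.IsSimple)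
    (n : ℕ) (v : B.V n) : 0 < q n v := by
  have hne : ∀ n, q n ≠ 0 := by
    intro n
    induction n with
    | zero =>
      intro h
      have := hq.root (Classical.arbitrary _)
      simp [h] at this
    | succ n ih =>
      intro h
      exact ih (by rw [hq.step, h, Matrix.mulVec_zero])
  obtain ⟨j, hj⟩ := hB.exists_transProd_pos n
  rw [eq_transProd_mulVec n j fun n _ => hq.step n]
  obtain ⟨w, hw⟩ := Function.ne_iff.1 (hne (n + j + 1))
  exact Finset.sum_pos' (fun u _ => mul_nonneg (transProd_nonneg _ _ _ _) (hq.nonneg _ _))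
    ⟨w, Finset.mem_univ _, mul_pos (hj j le_rfl v w) ((hq.nonneg _ _).lt_of_ne' hw)⟩

lemma exists_seq_of_terminal (N : ℕ) (x : B.V N → ℝ) (hx : ∀ v, 0 ≤ x v) :
    ∃ q : ∀ n, B.V n → ℝ, q N = x ∧ (∀ n v, 0 ≤ q n v) ∧
      (∀ n < N, q n = (B.incMat n).transpose.mulVec (q (n + 1))) ∧ ∀ n > N, q n = 0 := by
  induction N with
  | zero =>
    refine ⟨Function.update 0 0 x, by simp, fun n v => ?_, by simp, fun n hn => ?_⟩
    · rcases eq_or_ne n 0 with rfl | h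
      · simpa using hx v
      · simp [Function.update_of_ne h]
    · simp [Function.update_of_ne hn.ne']
  | succ N ih =>
    obtain ⟨q, hqN, hq0, hq, hqz⟩ := ih ((B.incMat N).transpose.mulVec x) fun v =>
      Finset.sum_nonneg fun u _ => mul_nonneg (incMat_nonneg _ _ _) (hx u)
    refine ⟨Function.update q (N + 1) x, by simp, fun n v => ?_, fun n hn => ?_, fun n hn => ?_⟩
    · rcases eq_or_ne n (N + 1) with rfl | h
      · simpa using hx v
      · simpa [Function.update_of_ne h] using hq0 n v
    · rw [Function.update_of_ne hn.ne]
      rcases Nat.lt_succ_iff_lt_or_eq.1 hn with h | rfl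
      · rw [Function.update_of_ne (by omega), hq n h]
      · rw [Function.update_self, hqN]
    · rw [Function.update_of_ne hn.ne', hqz n (by omega)]

lemma le_root_of_step {q : ∀ n, B.V n → ℝ} {N : ℕ} (hq0 : ∀ n v, 0 ≤ q n v)
    (hq : ∀ n < N, q n = (B.incMat n).transpose.mulVec (q (n + 1))) (r : B.V 0) :
    ∀ n ≤ N, ∀ v, q n v ≤ q 0 r := by
  classical
  intro n
  induction n with
  | zero => exact fun _ v => by rw [B.root_subsingleton v r]
  | succ n ih =>
    intro hn v
    obtain ⟨e, rfl⟩ := B.rng_surj n v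
    refine le_trans ?_ (ih (by omega) (B.src n e))
    rw [hq n hn, incMat_transpose_mulVec]
    exact Finset.single_le_sum (f := fun e => q (n + 1) (B.rng n e)) (fun _ _ => hq0 _ _)
      (by simp)

open Classical in
lemma exists_normalized_seq_of_vertex (N : ℕ) (k : B.V N) :
    ∃ q : ∀ n, B.V n → ℝ, (∀ n v, q n v ∈ Set.Icc (0 : ℝ) 1) ∧ (∀ v, q 0 v = 1) ∧
      (∀ n < N, q n = (B.incMat n).transpose.mulVec (q (n + 1))) ∧
      ∃ c : ℝ, 0 < c ∧ q N = c • Pi.single k 1 := by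
  obtain ⟨q, hqN, hq0, hq, hqz⟩ := exists_seq_of_terminal N (Pi.single k (1 : ℝ))
    (fun v => by rcases eq_or_ne v k with rfl | h <;> simp [*])
  obtain ⟨r⟩ := B.nonemptyV 0
  have hle := le_root_of_step hq0 hq r
  have hr : 0 < q 0 r := by
    have := hle N le_rfl k
    rw [hqN, Pi.single_eq_same] at this
    exact one_pos.trans_le this
  refine ⟨fun n => (q 0 r)⁻¹ • q n, fun n v => ⟨mul_nonneg (inv_nonneg.2 hr.le) (hq0 n v), ?_⟩,
    fun v => ?_, fun n hn => ?_, (q 0 r)⁻¹, inv_pos.2 hr, by simp only [hqN]⟩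
  · have : q n v ≤ q 0 r := by
      rcases le_or_gt n N with h | h
      · exact hle n h v
      · simpa [hqz n h] using hr.le
    exact (inv_mul_le_one₀ hr).2 this
  · rw [B.root_subsingleton v r]
    exact inv_mul_cancel₀ hr.ne'
  · rw [Matrix.mulVec_smul, ← hq n hn]

open Filter Topology in
/-- Cluster points of sequences compatible with the incidence matrices up to larger and larger
levels are invariant sequences. -/
lemma isInvariantSeq_of_mapClusterPt {J : Type*} {l : Filter J} {lev : J → ℕ}
    (hlev : Tendsto lev l atTop) {Q : J → ∀ n, B.V n → ℝ} (h0 : ∀ a n v, 0 ≤ Q a n v)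
    (h1 : ∀ a v, Q a 0 v = 1)
    (hs : ∀ a, ∀ n < lev a, Q a n = (B.incMat n).transpose.mulVec (Q a (n + 1)))
    {q : ∀ n, B.V n → ℝ} (hq : MapClusterPt q l Q) : B.IsInvariantSeq q := by
  have key : ∀ s : Set (∀ n, B.V n → ℝ), IsClosed s → (∀ᶠ a in l, Q a ∈ s) → q ∈ s :=
    fun s hs hmem => hs.closure_eq ▸ mem_closure_iff_clusterPt.2
      (ClusterPt.mono hq (le_principal_iff.2 hmem))
  have hc : ∀ n, Continuous fun q : ∀ n, B.V n → ℝ => q n := continuous_apply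
  have hc' : ∀ n v, Continuous fun q : ∀ n, B.V n → ℝ => q n v := fun n v =>
    (continuous_apply v).comp (hc n)
  refine ⟨fun n v => ?_, fun v => ?_, fun n => ?_⟩
  · exact key {q | 0 ≤ q n v} (isClosed_le continuous_const (hc' n v)) (.of_forall (h0 · n v))
  · exact key {q | q 0 v = 1} (isClosed_eq (hc' 0 v) continuous_const) (.of_forall (h1 · v))
  · refine key {q | q n = (B.incMat n).transpose.mulVec (q (n + 1))}
      (isClosed_eq (hc n) (Continuous.matrix_mulVec continuous_const (hc (n + 1)))) ?_
    filter_upwards [hlev.eventually_gt_atTop n] with a ha using hs a n ha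

lemma isCompact_unitBox :
    IsCompact {q : ∀ n, B.V n → ℝ | ∀ n v, q n v ∈ Set.Icc (0 : ℝ) 1} := by
  have := isCompact_univ_pi fun n => isCompact_univ_pi fun _ : B.V n => isCompact_Icc (a := (0:ℝ))
    (b := 1)
  convert this using 1
  ext q
  simp only [Set.mem_pi, Set.mem_univ, true_imp_iff]
  rfl

open Filter in
lemma exists_isInvariantSeq : ∃ q, B.IsInvariantSeq q := by
  choose Q hQ h1 hs _ using fun N => exists_normalized_seq_of_vertex N (Classical.arbitrary (B.V N))
  obtain ⟨q, -, hq⟩ := isCompact_unitBox.exists_mapClusterPt (f := atTop) (u := Q)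
    (tendsto_principal.2 (.of_forall hQ))
  exact ⟨q, isInvariantSeq_of_mapClusterPt tendsto_id (fun a n v => (hQ a n v).1) h1 hs hq⟩

/-! ### Unique ergodicity on the level of invariant sequences -/

open Filter Topology in
lemma IsInvariantSeq.tendsto_birkhoffTau {p : ∀ n, B.V n → ℝ} (hp : B.IsInvariantSeq p)
    (hB : B.IsSimple) (huniq : ∀ q, B.IsInvariantSeq q → q = p) (m : ℕ) :
    Tendsto (fun j => birkhoffTau (B.transProd m j)) atTop (𝓝 0) := by
  classical
  choose Q hQ h1 hs c hc hQc using
    fun a : Σ N, B.V N => exists_normalized_seq_of_vertex a.1 a.2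
  set l : Filter (Σ N, B.V N) := comap Sigma.fst atTop with hl
  have hlim : Tendsto Q l (𝓝 p) :=
    isCompact_unitBox.tendsto_nhds_of_unique_mapClusterPt (.of_forall hQ) fun q _ hq =>
      huniq q (isInvariantSeq_of_mapClusterPt tendsto_comap (fun a n v => (hQ a n v).1) h1 hs hq)
  have hlim' : ∀ v : B.V m, Tendsto (fun a => Q a m v) l (𝓝 (p m v)) := fun v =>
    tendsto_pi_nhds.1 (tendsto_pi_nhds.1 hlim m) v
  obtain ⟨j₀, hj₀⟩ := hB.exists_transProd_pos m
  have main : ∀ δ > 0, ∀ᶠ j in atTop, birkhoffTau (B.transProd m j) ≤ δ := by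
    intro δ hδ
    have hev : ∀ᶠ ab in l ×ˢ l, ∀ v w : B.V m,
        Q ab.1 m v * Q ab.2 m w < (1 + δ) * (Q ab.1 m w * Q ab.2 m v) := by
      refine eventually_all.2 fun v => eventually_all.2 fun w => ?_
      refine Tendsto.eventually_lt
        (((hlim' v).comp tendsto_fst).mul ((hlim' w).comp tendsto_snd))
        ((((hlim' w).comp tendsto_fst).mul ((hlim' v).comp tendsto_snd)).const_mul (1 + δ)) ?_
      have := mul_pos (hp.pos hB m v) (hp.pos hB m w)
      nlinarith
    obtain ⟨s, hsl, hs'⟩ := eventually_prod_self_iff'.1 hev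
    obtain ⟨t, ht, hts⟩ := mem_comap.1 hsl
    obtain ⟨N₀, hN₀⟩ := mem_atTop_sets.1 ht
    filter_upwards [eventually_ge_atTop (max j₀ N₀)] with j hj
    refine birkhoffTau_le (hj₀ j (le_of_max_le_left hj)) hδ.le fun v w k k' => ?_
    have hmem : ∀ k : B.V (m + j + 1), (⟨m + j + 1, k⟩ : Σ N, B.V N) ∈ s := fun k =>
      hts (hN₀ _ (by have := le_of_max_le_right hj; show N₀ ≤ m + j + 1; omega))
    have hcol : ∀ (k : B.V (m + j + 1)) v, Q ⟨m + j + 1, k⟩ m v =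
        c ⟨m + j + 1, k⟩ * B.transProd m j v k := fun k v => by
      rw [eq_transProd_mulVec m j (hs ⟨m + j + 1, k⟩), hQc ⟨m + j + 1, k⟩, Matrix.mulVec_smul]
      simp
    have h := (hs' _ (hmem k) _ (hmem k') v w).le
    simp only [hcol] at h
    have hcc := mul_pos (hc ⟨m + j + 1, k⟩) (hc ⟨m + j + 1, k'⟩)
    refine le_of_mul_le_mul_left ?_ hcc
    linarith
  refine tendsto_order.2 ⟨fun a ha => ?_, fun a ha => ?_⟩
  · filter_upwards [eventually_ge_atTop j₀] with j hj
    exact ha.trans_le (birkhoffTau_nonneg (hj₀ j hj))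
  · filter_upwards [main (a / 2) (half_pos ha)] with j hj
    linarith

open Filter Topology in
lemma IsInvariantSeq.eq_of_tendsto_birkhoffTau {p q : ∀ n, B.V n → ℝ}
    (hp : B.IsInvariantSeq p) (hq : B.IsInvariantSeq q) (hB : B.IsSimple)
    (h : ∀ m, Tendsto (fun j => birkhoffTau (B.transProd m j)) atTop (𝓝 0)) : q = p := by
  have hratio : ∀ m (i j : B.V m), q m j / p m j ≤ q m i / p m i →
      q m j / p m j = q m i / p m i := by
    intro m i j hle
    set u := q m i / p m i with hu
    set v := q m j / p m j with hv
    have hv0 : 0 < v := div_pos (hq.pos hB m j) (hp.pos hB m j)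
    obtain ⟨j₀, hj₀⟩ := hB.exists_transProd_pos m
    have hlim : Tendsto (fun n => 4 * (u * v) *
        Real.exp (birkhoffTau (B.transProd m n) * Real.log (u / v))) atTop
        (𝓝 (4 * (u * v) * Real.exp (0 * Real.log (u / v)))) :=
      ((Real.continuous_exp.tendsto _).comp ((h m).mul_const _)).const_mul _
    have hle2 := ge_of_tendsto hlim (b := (u + v) ^ 2) (by
      filter_upwards [eventually_ge_atTop j₀] with n hn
      have hpm := eq_transProd_mulVec m n fun n _ => hp.step n
      have hqm := eq_transProd_mulVec m n fun n _ => hq.step n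
      refine sq_le_of_birkhoffTau (hj₀ n hn) (hp.pos hB (m + n + 1)) (hq.pos hB (m + n + 1))
        (i := i) (j := j) ?_ ?_ hv0 hle
      · rw [← hpm, ← hqm, hu, div_mul_cancel₀ _ (hp.pos hB m i).ne']
      · rw [← hpm, ← hqm, hv, div_mul_cancel₀ _ (hp.pos hB m j).ne'])
    rw [zero_mul, Real.exp_zero, mul_one] at hle2
    have h0 : (v - u) ^ 2 = 0 := le_antisymm (by linarith) (sq_nonneg _)
    exact sub_eq_zero.1 (pow_eq_zero_iff two_ne_zero |>.1 h0)
  have hprop : ∀ m, ∃ c : ℝ, q m = c • p m := by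
    intro m
    obtain ⟨i⟩ := B.nonemptyV m
    refine ⟨q m i / p m i, funext fun j => ?_⟩
    have : q m j / p m j = q m i / p m i := by
      rcases le_total (q m j / p m j) (q m i / p m i) with h | h
      · exact hratio m i j h
      · exact (hratio m j i h).symm
    rw [Pi.smul_apply, smul_eq_mul, ← this, div_mul_cancel₀ _ (hp.pos hB m j).ne']
  have hdown : ∀ m (c : ℝ), q m = c • p m → c = 1 := by
    intro m
    induction m with
    | zero =>
      intro c hc
      have := congrFun hc (Classical.arbitrary _)
      simpa [hp.root, hq.root] using this.symm
    | succ m ih =>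
      intro c hc
      refine ih c ?_
      rw [hq.step, hp.step, hc, Matrix.mulVec_smul]
  funext m
  obtain ⟨c, hc⟩ := hprop m
  rw [hc, hdown m c hc, one_smul]

end BratteliDiagram

namespace BratteliDiagram

variable {B : BratteliDiagram}

/-! ### Invariant measures and invariant sequences -/

open Classical in
lemma exists_edge_extensions (n : ℕ) (x : B.PathSpace) :
    ∃ y : B.E n → B.PathSpace,
      ∀ e, B.src n e = B.endVtx n x → y e ∈ B.cyl n x ∧ (y e).1 n = e := by
  refine ⟨fun e => if h : B.src n e = B.endVtx n x then
    (exists_mem_cyl_of_edge n x e h).choose else x, fun e he => ?_⟩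
  simp only [dif_pos he]
  exact (exists_mem_cyl_of_edge n x e he).choose_spec

open Classical in
lemma measure_cyl_eq_sum (μ : Measure B.PathSpace) (n : ℕ) (x : B.PathSpace)
    {y : B.E n → B.PathSpace}
    (hy : ∀ e, B.src n e = B.endVtx n x → y e ∈ B.cyl n x ∧ (y e).1 n = e) :
    μ (B.cyl n x) = ∑ e with B.src n e = B.endVtx n x, μ (B.cyl (n + 1) (y e)) := by
  have hU : B.cyl n x =
      ⋃ e ∈ ({e | B.src n e = B.endVtx n x} : Finset (B.E n)), B.cyl (n + 1) (y e) := by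
    ext z
    simp only [Set.mem_iUnion, Finset.mem_filter, Finset.mem_univ, true_and, exists_prop]
    constructor
    · intro hz
      have he : B.src n (z.1 n) = B.endVtx n x := endVtx_eq_of_mem_cyl hz
      refine ⟨z.1 n, he, mem_cyl_succ.2 ⟨?_, (hy _ he).2.symm⟩⟩
      rwa [cyl_eq_of_mem (hy _ he).1]
    · rintro ⟨e, he, hz⟩
      rw [← cyl_eq_of_mem (hy e he).1]
      exact (mem_cyl_succ.1 hz).1
  rw [hU]
  refine measure_biUnion_finset (fun e he e' he' hne => ?_) fun e _ => measurableSet_cyl _ _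
  refine Set.disjoint_left.2 fun z hz hz' => hne ?_
  simp only [Finset.coe_filter, Finset.mem_univ, true_and, Set.mem_ofPred_eq] at he he'
  rw [← (hy e he).2, ← (hy e' he').2, ← (mem_cyl_succ.1 hz).2, ← (mem_cyl_succ.1 hz').2]

/-- The cylinder values of an invariant measure form an invariant sequence. -/
lemma exists_isInvariantSeq_of_measure (μ : Measure B.PathSpace) [IsProbabilityMeasure μ]
    (hμ : B.TailInvariant μ) :
    ∃ q, B.IsInvariantSeq q ∧ ∀ n x, μ (B.cyl n x) = ENNReal.ofReal (q n (B.endVtx n x)) := by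
  classical
  choose path hpath using exists_path_endVtx (B := B)
  have hval : ∀ n x, μ.real (B.cyl n x) = μ.real (B.cyl n (path n (B.endVtx n x))) := fun n x => by
    rw [measureReal_def, hμ n x _ (hpath n _).symm, measureReal_def]
  refine ⟨fun n v => μ.real (B.cyl n (path n v)),
    ⟨fun _ _ => measureReal_nonneg, fun v => ?_, fun n => ?_⟩, fun n x => ?_⟩
  · rw [cyl_zero, probReal_univ]
  · funext w
    obtain ⟨y, hy⟩ := exists_edge_extensions n (path n w)
    rw [incMat_transpose_mulVec, measureReal_def, measure_cyl_eq_sum μ n _ hy,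
      ENNReal.toReal_sum fun _ _ => measure_ne_top _ _, hpath]
    refine Finset.sum_congr rfl fun e he => ?_
    have he' : B.src n e = B.endVtx n (path n w) := by
      rw [hpath]
      exact (Finset.mem_filter.1 he).2
    rw [← measureReal_def, hval, ← rng_eq_endVtx, (hy e he').2]
  · dsimp only
    rw [← hval, ofReal_measureReal]

/-- For each `k` there is a measure concentrated on a given cylinder of level `n` whose values on
subcylinders agree with the invariant sequence up to level `n + k`. -/
lemma exists_measure_on_cyl {q : ∀ n, B.V n → ℝ} (hq : B.IsInvariantSeq q) (k : ℕ) :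
    ∀ (n : ℕ) (x : B.PathSpace), ∃ ν : Measure B.PathSpace, ν (B.cyl n x)ᶜ = 0 ∧
      ∀ m, n ≤ m → m ≤ n + k → ∀ y ∈ B.cyl n x,
        ν (B.cyl m y) = ENNReal.ofReal (q m (B.endVtx m y)) := by
  classical
  induction k with
  | zero =>
    intro n x
    refine ⟨ENNReal.ofReal (q n (B.endVtx n x)) • Measure.dirac x, ?_, fun m hm hm' y hy => ?_⟩
    · rw [Measure.smul_apply, Measure.dirac_apply' _ (measurableSet_cyl n x).compl]
      simp [mem_cyl_self]
    · obtain rfl : m = n := by omega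
      rw [cyl_eq_of_mem hy, endVtx_eq_of_mem_cyl hy, Measure.smul_apply,
        Measure.dirac_apply' _ (measurableSet_cyl m x)]
      simp [mem_cyl_self]
  | succ k ih =>
    intro n x
    obtain ⟨y, hy⟩ := exists_edge_extensions n x
    choose ν hν0 hν using fun e => ih (n + 1) (y e)
    have hle : ∀ e s, Disjoint s (B.cyl (n + 1) (y e)) → ν e s = 0 := fun e s hs =>
      measure_mono_null (Set.subset_compl_iff_disjoint_right.2 hs) (hν0 e)
    refine ⟨∑ e with B.src n e = B.endVtx n x, ν e, ?_, fun m hm hm' z hz => ?_⟩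
    · rw [Measure.finsetSum_apply]
      refine Finset.sum_eq_zero fun e he => hle e _ ?_
      rw [← cyl_eq_of_mem (hy e (Finset.mem_filter.1 he).2).1]
      exact (Set.disjoint_left.2 fun w hw hw' => hw (cyl_anti n.le_succ _ hw'))
    · rw [Measure.finsetSum_apply]
      rcases hm.eq_or_lt with rfl | hlt
      · rw [cyl_eq_of_mem hz, endVtx_eq_of_mem_cyl hz, hq.step, incMat_transpose_mulVec,
          ENNReal.ofReal_sum_of_nonneg fun _ _ => hq.nonneg _ _]
        refine Finset.sum_congr rfl fun e he => ?_
        have hye := hy e (Finset.mem_filter.1 he).2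
        have hsub : B.cyl (n + 1) (y e) ⊆ B.cyl n x := by
          rw [← cyl_eq_of_mem hye.1]
          exact cyl_anti n.le_succ _
        have h1 := hν e (n + 1) le_rfl (by omega) (y e) (mem_cyl_self _ _)
        rw [← rng_eq_endVtx, hye.2] at h1
        rw [← h1]
        refine le_antisymm ?_ (measure_mono hsub)
        calc ν e (B.cyl n x)
            ≤ ν e (B.cyl (n + 1) (y e) ∪ (B.cyl (n + 1) (y e))ᶜ) :=
              measure_mono (by simp)
          _ ≤ _ := (measure_union_le _ _).trans (by rw [hν0, add_zero])
      · have he0 : B.src n (z.1 n) = B.endVtx n x := endVtx_eq_of_mem_cyl hz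
        rw [Finset.sum_eq_single (z.1 n)]
        · refine hν _ m hlt (by omega) z (mem_cyl_succ.2 ⟨?_, (hy _ he0).2.symm⟩)
          rwa [cyl_eq_of_mem (hy _ he0).1]
        · intro e he hne
          refine hle e _ (Set.disjoint_left.2 fun w hw hw' => hne ?_)
          rw [← (hy e (Finset.mem_filter.1 he).2).2, ← (mem_cyl_succ.1 hw').2]
          exact hw n hlt
        · exact fun h => (h (by simpa using he0)).elim

open Filter Topology in
/-- Every invariant sequence gives the cylinder values of an invariant probability measure. -/
lemma IsInvariantSeq.exists_measure {q : ∀ n, B.V n → ℝ} (hq : B.IsInvariantSeq q) :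
    ∃ μ : Measure B.PathSpace, IsProbabilityMeasure μ ∧ B.TailInvariant μ ∧
      ∀ n x, μ (B.cyl n x) = ENNReal.ofReal (q n (B.endVtx n x)) := by
  let x₀ : B.PathSpace := Classical.arbitrary _
  choose ν _ hν using fun k => exists_measure_on_cyl hq k 0 x₀
  have hν' : ∀ k n, n ≤ k → ∀ x, ν k (B.cyl n x) = ENNReal.ofReal (q n (B.endVtx n x)) :=
    fun k n hn x => hν k n n.zero_le (by omega) x (by rw [cyl_zero]; trivial)
  have hprob : ∀ k, IsProbabilityMeasure (ν k) := fun k =>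
    ⟨by rw [← cyl_zero x₀, hν' k 0 k.zero_le, hq.root, ENNReal.ofReal_one]⟩
  let P : ℕ → ProbabilityMeasure B.PathSpace := fun k => ⟨ν k, hprob k⟩
  obtain ⟨μ, -, hμ⟩ := isCompact_univ.ultrafilter_le_nhds ((hyperfilter ℕ).map P) (by simp)
  have hcyl : ∀ n x, (μ : Measure B.PathSpace) (B.cyl n x) =
      ENNReal.ofReal (q n (B.endVtx n x)) := by
    intro n x
    have hlim := ProbabilityMeasure.tendsto_measure_of_null_frontier_of_tendsto'
      (L := (hyperfilter ℕ : Filter ℕ)) (μs := P) (μ := μ) hμ (E := B.cyl n x)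
      (by rw [(isClopen_cyl n x).frontier_eq, measure_empty])
    refine tendsto_nhds_unique hlim (tendsto_const_nhds.congr' ?_)
    have : ∀ᶠ k in (hyperfilter ℕ : Filter ℕ), n ≤ k :=
      Nat.hyperfilter_le_atTop (eventually_ge_atTop n)
    filter_upwards [this] with k hk using (hν' k n hk x).symm
  exact ⟨μ, inferInstance, fun n x y h => by rw [hcyl, hcyl, h], hcyl⟩

end BratteliDiagram

/-- **Bezuglyi–Kwiatkowski–Medynets–Solomyak.** A simple finite rank Bratteli diagram is
uniquely ergodic iff the Birkhoff contraction coefficients of the products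
`A_m A_{m+1} ⋯ A_n` of transposed incidence matrices tend to `0` for every `m`. -/
theorem simple_finite_rank_uniquely_ergodic_iff_birkhoffTau
    (B : BratteliDiagram)
    (hCantor : ∀ x : B.PathSpace, ¬IsOpen ({x} : Set B.PathSpace))
    (hsimple : B.IsSimple) (hfr : B.FiniteRank) :
    (∃! μ : Measure B.PathSpace, IsProbabilityMeasure μ ∧ B.TailInvariant μ) ↔
      ∀ m : ℕ, Filter.Tendsto (fun j : ℕ => birkhoffTau (B.transProd m j))
        Filter.atTop (nhds 0) := by
  constructor
  · rintro ⟨μ, ⟨hμ, hinv⟩, huniq⟩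
    obtain ⟨p, hp, hpμ⟩ := BratteliDiagram.exists_isInvariantSeq_of_measure μ hinv
    refine hp.tendsto_birkhoffTau hsimple fun q hq => ?_
    obtain ⟨ν, hν, hνinv, hqν⟩ := hq.exists_measure
    have hνμ : ν = μ := huniq ν ⟨hν, hνinv⟩
    funext n v
    obtain ⟨x, rfl⟩ := BratteliDiagram.exists_path_endVtx n v
    rw [← ENNReal.toReal_ofReal (hq.nonneg n _), ← hqν, hνμ, hpμ,
      ENNReal.toReal_ofReal (hp.nonneg n _)]
  · intro h
    obtain ⟨p, hp⟩ := BratteliDiagram.exists_isInvariantSeq (B := B)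
    obtain ⟨μ, hμ, hinv, hpμ⟩ := hp.exists_measure
    refine ⟨μ, ⟨hμ, hinv⟩, ?_⟩
    rintro ν ⟨hν, hνinv⟩
    obtain ⟨q, hq, hqν⟩ := BratteliDiagram.exists_isInvariantSeq_of_measure ν hνinv
    refine BratteliDiagram.measure_ext_cyl fun n x => ?_
    rw [hqν, hpμ, hp.eq_of_tendsto_birkhoffTau hq hsimple h]
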